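/- arXiv:1712.06692 — 3 statements merged into one kernel-verified Lean document; each statement's English description precedes it below -/
import Mathlib

section
/- The number of cyclic subgroups of ZM(m,n,r) equals the sum of gcd(m₁, (r^n−1)/(r^{n₁}−1)) over all pairs (m₁, n₁) with m₁ | m, n₁ | n and (m/m₁) | (r^{n₁}−1). -/
/-- The relators of the Zassenhaus metacyclic group
`ZM(m,n,r) = ⟨a, b | a^m = b^n = 1, b⁻¹ab = a^r⟩`. -/
def ZMrel (m n r : ℕ) : Set (FreeGroup (Fin 2)) :=
  {FreeGroup.of 0 ^ m, FreeGroup.of 1 ^ n,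
   (FreeGroup.of 1)⁻¹ * FreeGroup.of 0 * FreeGroup.of 1 * (FreeGroup.of 0 ^ r)⁻¹}

/-- The ZM-group `ZM(m,n,r)` as a presented group. -/
abbrev ZM (m n r : ℕ) : Type := PresentedGroup (ZMrel m n r)

/-- The generator `a` of `ZM(m,n,r)`. -/
def za (m n r : ℕ) : ZM m n r := PresentedGroup.of 0

/-- The generator `b` of `ZM(m,n,r)`. -/
def zb (m n r : ℕ) : ZM m n r := PresentedGroup.of 1

open Subgroup Multiplicative

/-- The exponents `k` for which `g ^ k` lies in a given subgroup are the multiples of a divisor of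
any exponent that kills `g`. -/
theorem exists_dvd_forall_zpow_mem_iff {G : Type*} [Group G] (K : Subgroup G) {g : G} {N : ℕ}
    (hg : g ^ N = 1) : ∃ d : ℕ, d ∣ N ∧ ∀ k : ℤ, g ^ k ∈ K ↔ (d : ℤ) ∣ k := by
  let A : AddSubgroup ℤ :=
    { carrier := {k | g ^ k ∈ K}
      zero_mem' := by simp
      add_mem' := fun {x y} hx hy => by
        simpa only [Set.mem_ofPred_eq, zpow_add] using K.mul_mem hx hy
      neg_mem' := fun {x} hx => by
        simpa only [Set.mem_ofPred_eq, zpow_neg] using K.inv_mem hx }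
  obtain ⟨c, hc⟩ := Int.subgroup_cyclic A
  have hmem : ∀ k : ℤ, g ^ k ∈ K ↔ (c.natAbs : ℤ) ∣ k := fun k => by
    rw [Int.natAbs_dvd, ← Int.mem_zmultiples_iff, AddSubgroup.zmultiples_eq_closure, ← hc]
    rfl
  refine ⟨c.natAbs, ?_, hmem⟩
  have := (hmem N).1 (by rw [zpow_natCast, hg]; exact K.one_mem)
  exact_mod_cast this

theorem mem_zpowers_sup_zpowers_of_commute {G : Type*} [Group G] {x y : G} (h : Commute x y)
    {g : G} : g ∈ zpowers x ⊔ zpowers y ↔ ∃ i j : ℤ, x ^ i * y ^ j = g := by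
  constructor
  · intro hg
    rw [sup_eq_closure] at hg
    induction hg using closure_induction with
    | mem z hz =>
      rcases hz with ⟨i, rfl⟩ | ⟨j, rfl⟩
      · exact ⟨i, 0, by simp⟩
      · exact ⟨0, j, by simp⟩
    | one => exact ⟨0, 0, by simp⟩
    | mul z w _ _ hz hw =>
      obtain ⟨i, j, rfl⟩ := hz
      obtain ⟨k, l, rfl⟩ := hw
      refine ⟨i + k, j + l, ?_⟩
      rw [zpow_add, zpow_add]
      have := (h.zpow_zpow k j).eq
      simp only [mul_assoc]
      rw [← mul_assoc (x ^ k), this, mul_assoc]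
    | inv z _ hz =>
      obtain ⟨i, j, rfl⟩ := hz
      refine ⟨-i, -j, ?_⟩
      rw [mul_inv_rev, zpow_neg, zpow_neg]
      exact (h.zpow_zpow i j).inv_inv.eq
  · rintro ⟨i, j, rfl⟩
    exact mul_mem (mem_sup_left (zpow_mem (mem_zpowers x) i))
      (mem_sup_right (zpow_mem (mem_zpowers y) j))

/-- Two commuting elements `x`, `y` with `x ^ p ∈ ⟨y⟩` and `y ^ q = 1`, where `p` and `q` are
coprime, generate a cyclic subgroup. -/
theorem isCyclic_zpowers_sup_zpowers {G : Type*} [Group G] {x y : G} (h : Commute x y)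
    {p q : ℕ} (hpq : p.Coprime q) (hx : x ^ p ∈ zpowers y) (hy : y ^ q = 1) :
    IsCyclic (zpowers x ⊔ zpowers y : Subgroup G) := by
  obtain ⟨c, hc⟩ := hx
  obtain ⟨u, v, huv⟩ := Nat.isCoprime_iff_coprime.2 hpq
  set t := u * (1 - c) with ht
  have hw : (x * y ^ t) ^ p = y := by
    rw [(h.zpow_right t).mul_pow, ← hc, ← zpow_natCast, ← zpow_mul]
    change y ^ c * y ^ (t * (p : ℤ)) = y
    have e : c + t * p = 1 + q * (-v * (1 - c)) := by
      linear_combination (1 - c) * huv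
    rw [← zpow_add, e, zpow_add, zpow_mul, zpow_natCast, hy, one_zpow, zpow_one, mul_one]
  have hyw : y ∈ zpowers (x * y ^ t) := ⟨p, by simpa using hw⟩
  have hxw : x ∈ zpowers (x * y ^ t) := by
    simpa using mul_mem (mem_zpowers (x * y ^ t)) (zpow_mem hyw (-t))
  have : zpowers x ⊔ zpowers y = zpowers (x * y ^ t) := by
    refine le_antisymm (sup_le (by simpa using hxw) (by simpa using hyw)) ?_
    rw [zpowers_le]
    exact mul_mem (mem_sup_left (mem_zpowers x)) (mem_sup_right (zpow_mem (mem_zpowers y) t))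
  rw [this]
  infer_instance

theorem zpow_mem_zpowers_pow {G : Type*} [Group G] (a : G) (d : ℕ) {k : ℤ} (hk : (d : ℤ) ∣ k) :
    a ^ k ∈ zpowers (a ^ d) := by
  obtain ⟨l, rfl⟩ := hk
  exact ⟨l, by simp [zpow_mul]⟩

theorem card_filter_range_dvd_mul {d : ℕ} (hd : 0 < d) (Q : ℕ) :
    ((Finset.range d).filter fun s => d ∣ s * Q).card = d.gcd Q := by
  have hg : 0 < d.gcd Q := Nat.gcd_pos_of_pos_left _ hd
  obtain ⟨e, he⟩ := Nat.gcd_dvd_left d Q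
  have he0 : 0 < e := Nat.pos_of_ne_zero (by rintro rfl; omega)
  have hdvd : ∀ s, d ∣ s * Q ↔ e ∣ s := fun s => by
    rw [← Nat.dvd_mul_gcd_iff_dvd_mul, mul_comm s]
    nth_rw 1 [he]
    exact Nat.mul_dvd_mul_iff_left hg
  have : ((Finset.range d).filter fun s => d ∣ s * Q)
      = (Finset.range (d.gcd Q)).image (e * ·) := by
    ext s
    simp only [Finset.mem_filter, Finset.mem_range, Finset.mem_image, hdvd]
    constructor
    · rintro ⟨hs, k, rfl⟩
      refine ⟨k, ?_, rfl⟩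
      rw [he, mul_comm] at hs
      exact Nat.lt_of_mul_lt_mul_right hs
    · rintro ⟨k, hk, rfl⟩
      refine ⟨?_, dvd_mul_right _ _⟩
      rw [he, mul_comm]
      exact Nat.mul_lt_mul_of_pos_right hk he0
  rw [this, Finset.card_image_of_injective _ (mul_right_injective₀ he0.ne'), Finset.card_range]

/-- The elements `a` and `b` of `G` satisfy the relations of `ZM(m,n,r)`, `a` has order exactly
`m`, and `π` realises `G ⧸ ⟨a⟩` as the cyclic group of order `n` generated by the image of `b`. -/
structure IsZMPair {G : Type*} [Group G] (m n r : ℕ) (a b : G)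
    (π : G →* Multiplicative (ZMod n)) : Prop where
  orderOf_left : orderOf a = m
  mul_eq : a * b = b * a ^ r
  map_right : π b = ofAdd 1
  ker_eq : π.ker = zpowers a
  pow_right : b ^ n = 1

namespace IsZMPair

variable {G : Type*} [Group G] {m n r : ℕ} {a b : G} {π : G →* Multiplicative (ZMod n)}

theorem map_left (h : IsZMPair m n r a b π) : π a = 1 := by
  rw [← MonoidHom.mem_ker, h.ker_eq]
  exact mem_zpowers a

theorem zpow_left_eq_one_iff (h : IsZMPair m n r a b π) {k : ℤ} : a ^ k = 1 ↔ (m : ℤ) ∣ k := by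
  rw [← h.orderOf_left, orderOf_dvd_iff_zpow_eq_one]

theorem zpow_map_right_eq_one_iff (h : IsZMPair m n r a b π) {k : ℤ} :
    π b ^ k = 1 ↔ (n : ℤ) ∣ k := by
  rw [h.map_right, ← ofAdd_zsmul, ofAdd_eq_one, zsmul_one, ZMod.intCast_zmod_eq_zero_iff_dvd]

theorem exists_map_eq_zpow (h : IsZMPair m n r a b π) (g : G) : ∃ k : ℤ, π g = π b ^ k := by
  obtain ⟨k, hk⟩ := ZMod.intCast_surjective (toAdd (π g))
  exact ⟨k, by rw [h.map_right, ← ofAdd_zsmul, zsmul_one, hk, ofAdd_toAdd]⟩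

theorem exists_eq_mul_zpow (h : IsZMPair m n r a b π) {g g' : G} (hg : π g = π g') :
    ∃ i : ℤ, g' = g * a ^ i := by
  have : g⁻¹ * g' ∈ zpowers a := by
    rw [← h.ker_eq, MonoidHom.mem_ker, map_mul, map_inv, hg, inv_mul_cancel]
  obtain ⟨i, hi⟩ := this
  exact ⟨i, by rw [show a ^ i = g⁻¹ * g' from hi, mul_inv_cancel_left]⟩

theorem pow_mul_pow (h : IsZMPair m n r a b π) (i j : ℕ) :
    a ^ i * b ^ j = b ^ j * a ^ (i * r ^ j) := by
  induction j with
  | zero => simp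
  | succ j ih =>
    have key : ∀ l : ℕ, a ^ l * b = b * a ^ (l * r) := fun l => by
      have : SemiconjBy b (a ^ r) a := h.mul_eq.symm
      rw [mul_comm l, pow_mul]
      exact (this.pow_right l).eq.symm
    rw [pow_succ, ← mul_assoc, ih, mul_assoc, key, ← mul_assoc, pow_succ, mul_assoc i]

theorem mul_pow (h : IsZMPair m n r a b π) (k s t : ℕ) :
    (b ^ k * a ^ s) ^ t = b ^ (k * t) * a ^ (s * ∑ i ∈ Finset.range t, (r ^ k) ^ i) := by
  induction t with
  | zero => simp
  | succ t ih =>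
    rw [pow_succ, ih, mul_assoc, ← mul_assoc (a ^ _) (b ^ k), h.pow_mul_pow, mul_assoc,
      ← mul_assoc (b ^ _), ← pow_add, ← pow_add, Finset.sum_range_succ']
    simp only [pow_zero, mul_add, mul_one, pow_succ, ← Finset.sum_mul, mul_assoc]

theorem mul_pow_div (h : IsZMPair m n r a b π) {k : ℕ} (hk : k ∣ n) (s : ℕ) :
    (b ^ k * a ^ s) ^ (n / k) = a ^ (s * ∑ i ∈ Finset.range (n / k), (r ^ k) ^ i) := by
  rw [h.mul_pow, Nat.mul_div_cancel' hk, h.pow_right, one_mul]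

theorem commute_iff (h : IsZMPair m n r a b π) (hr : 0 < r) (hm : 0 < m) {d : ℕ} (hd : d ∣ m)
    (k s : ℕ) : Commute (b ^ k * a ^ s) (a ^ d) ↔ m / d ∣ r ^ k - 1 := by
  have hd0 : 0 < d := Nat.pos_of_dvd_of_pos hd hm
  rw [commute_iff_eq, ← mul_assoc, h.pow_mul_pow, mul_assoc, mul_assoc, mul_right_inj, ← pow_add,
    ← pow_add, add_comm, pow_add, pow_add, mul_left_inj, pow_eq_pow_iff_modEq, h.orderOf_left,
    Nat.modEq_iff_dvd' (Nat.le_mul_of_pos_right d (Nat.pow_pos hr)),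
    show d * r ^ k - d = d * (r ^ k - 1) by rw [Nat.mul_sub, mul_one], Nat.div_dvd_iff_dvd_mul hd hd0]

/-- The subgroup `⟨b ^ k * a ^ s, a ^ d⟩`. -/
def sub (a b : G) (d k s : ℕ) : Subgroup G :=
  zpowers (b ^ k * a ^ s) ⊔ zpowers (a ^ d)

theorem map_mul_pow (h : IsZMPair m n r a b π) (k s : ℕ) : π (b ^ k * a ^ s) = π b ^ k := by
  rw [map_mul, map_pow, map_pow, h.map_left, one_pow, mul_one]

theorem isCyclic_sub (h : IsZMPair m n r a b π) {d k s : ℕ} (hd : d ∣ m) (hk : k ∣ n)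
    (hcomm : Commute (b ^ k * a ^ s) (a ^ d)) (hmn : m.Coprime n)
    (hs : d ∣ s * ∑ i ∈ Finset.range (n / k), (r ^ k) ^ i) : IsCyclic (sub a b d k s) := by
  refine isCyclic_zpowers_sup_zpowers hcomm (p := n / k) (q := m / d) ?_ ?_ ?_
  · exact (hmn.symm.coprime_dvd_left (Nat.div_dvd_of_dvd hk)).coprime_dvd_right
      (Nat.div_dvd_of_dvd hd)
  · rw [h.mul_pow_div hk, ← zpow_natCast a (s * _)]
    exact zpow_mem_zpowers_pow a d (Int.natCast_dvd_natCast.2 hs)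
  · rw [← pow_mul, Nat.mul_div_cancel' hd, ← h.orderOf_left, pow_orderOf_eq_one]

theorem zpow_left_mem_sub_iff (h : IsZMPair m n r a b π) {d k s : ℕ} (hd : d ∣ m) (hk : k ∣ n)
    (hcomm : Commute (b ^ k * a ^ s) (a ^ d))
    (hs : d ∣ s * ∑ i ∈ Finset.range (n / k), (r ^ k) ^ i)
    (hn : 0 < n) {l : ℤ} : a ^ l ∈ sub a b d k s ↔ (d : ℤ) ∣ l := by
  refine ⟨fun hl => ?_, fun hl => mem_sup_right (zpow_mem_zpowers_pow a d hl)⟩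
  obtain ⟨i, j, hij⟩ := (mem_zpowers_sup_zpowers_of_commute hcomm).1 hl
  have hk0 : (k : ℤ) ≠ 0 := by
    exact_mod_cast (Nat.pos_of_dvd_of_pos hk hn).ne'
  have hπ : π b ^ ((k : ℤ) * i) = 1 := by
    have := congrArg π hij
    rwa [map_mul, map_zpow, map_zpow, map_zpow, h.map_mul_pow, map_pow, h.map_left, one_pow,
      one_zpow, one_zpow, mul_one, ← zpow_natCast, ← zpow_mul] at this
  rw [h.zpow_map_right_eq_one_iff] at hπ
  have hi : ((n / k : ℕ) : ℤ) ∣ i := by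
    rw [← mul_dvd_mul_iff_left hk0, ← Nat.cast_mul, Nat.mul_div_cancel' hk]
    exact hπ
  obtain ⟨t, rfl⟩ := hi
  obtain ⟨e, he⟩ := hs
  rw [zpow_mul, zpow_natCast, h.mul_pow_div hk, he, ← zpow_natCast, ← zpow_natCast, ← zpow_mul,
    ← zpow_mul, ← zpow_add, ← mul_inv_eq_one, ← zpow_sub, h.zpow_left_eq_one_iff] at hij
  have hdl := (Int.natCast_dvd_natCast.2 hd).trans hij
  refine (dvd_sub_right (dvd_add ?_ (dvd_mul_right _ _))).1 hdl
  exact (Int.natCast_dvd_natCast.2 (dvd_mul_right d e)).mul_right t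

theorem zpow_mem_map_sub_iff (h : IsZMPair m n r a b π) {d k s : ℕ} (hk : k ∣ n) {l : ℤ} :
    π b ^ l ∈ (sub a b d k s).map π ↔ (k : ℤ) ∣ l := by
  have hmap : (sub a b d k s).map π = zpowers (π b ^ k) := by
    rw [sub, Subgroup.map_sup, MonoidHom.map_zpowers, MonoidHom.map_zpowers, h.map_mul_pow, map_pow,
      h.map_left, one_pow, zpowers_one_eq_bot, sup_bot_eq]
  rw [hmap, mem_zpowers_iff]
  constructor
  · rintro ⟨i, hi⟩
    rw [← zpow_natCast, ← zpow_mul, ← mul_inv_eq_one, ← zpow_sub, h.zpow_map_right_eq_one_iff] at hi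
    have := (Int.natCast_dvd_natCast.2 hk).trans hi
    exact (dvd_sub_right (dvd_mul_right _ _)).1 this
  · rintro ⟨i, rfl⟩
    exact ⟨i, by rw [zpow_mul, zpow_natCast]⟩

theorem exists_eq_sub (h : IsZMPair m n r a b π) (hm : 0 < m) (hr : 0 < r)
    (H : Subgroup G) [IsCyclic H] : ∃ d k s : ℕ, d ∣ m ∧ k ∣ n ∧ m / d ∣ r ^ k - 1 ∧ s < d ∧
      d ∣ s * ∑ i ∈ Finset.range (n / k), (r ^ k) ^ i ∧ sub a b d k s = H := by
  obtain ⟨d, hd, hdH⟩ := exists_dvd_forall_zpow_mem_iff H (g := a) (N := m)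
    (by rw [← h.orderOf_left, pow_orderOf_eq_one])
  obtain ⟨k, hk, hkH⟩ := exists_dvd_forall_zpow_mem_iff (H.map π) (g := π b) (N := n)
    (by rw [← map_pow, h.pow_right, map_one])
  have hd0 : (0 : ℤ) < d := by exact_mod_cast Nat.pos_of_dvd_of_pos hd hm
  obtain ⟨g, hgH, hg⟩ := (hkH k).2 dvd_rfl
  obtain ⟨i, hi⟩ := h.exists_eq_mul_zpow (g := b ^ k) (g' := g) (by rw [hg, map_pow, zpow_natCast])
  obtain ⟨s, hs⟩ := Int.eq_ofNat_of_zero_le (Int.emod_nonneg i hd0.ne')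
  have hsd : s < d := by exact_mod_cast hs ▸ Int.emod_lt_of_pos i hd0
  have hx : b ^ k * a ^ s ∈ H := by
    have e : b ^ k * a ^ s = g * a ^ ((d : ℤ) * -(i / d)) := by
      rw [hi, mul_assoc, ← zpow_add, ← zpow_natCast a s, ← hs]
      congr 2
      linear_combination Int.emod_add_mul_ediv i d
    rw [e]
    exact mul_mem hgH ((hdH _).2 (dvd_mul_right _ _))
  have hy : a ^ d ∈ H := by simpa using (hdH d).2 dvd_rfl
  refine ⟨d, k, s, hd, hk, ?_, hsd, ?_, ?_⟩
  · rw [← h.commute_iff hr hm hd k s]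
    let := IsCyclic.commGroup (α := H)
    exact congrArg Subtype.val (mul_comm (⟨_, hx⟩ : H) ⟨_, hy⟩)
  · have := pow_mem hx (n / k)
    rw [h.mul_pow_div hk, ← zpow_natCast, hdH] at this
    exact_mod_cast this
  · refine le_antisymm (sup_le (by simpa using hx) (by simpa using hy)) fun z hz => ?_
    obtain ⟨j, hj⟩ := h.exists_map_eq_zpow z
    obtain ⟨l, rfl⟩ := (hkH j).1 (hj ▸ mem_map_of_mem π hz)
    obtain ⟨c, hc⟩ := h.exists_eq_mul_zpow (g := (b ^ k * a ^ s) ^ l) (g' := z)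
      (by rw [hj, map_zpow, h.map_mul_pow, zpow_mul, zpow_natCast])
    have hcH : a ^ c ∈ H := by
      rw [← inv_mul_eq_iff_eq_mul] at hc
      exact hc ▸ mul_mem (inv_mem (zpow_mem hx l)) hz
    rw [hc]
    exact mul_mem (mem_sup_left (zpow_mem (mem_zpowers _) l))
      (mem_sup_right (zpow_mem_zpowers_pow a d ((hdH c).1 hcH)))

theorem card_isCyclic (h : IsZMPair m n r a b π) (hm : 0 < m) (hn : 0 < n) (hr : 0 < r)
    (hmn : m.Coprime n) :
    Nat.card {H : Subgroup G // IsCyclic H} =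
      ∑ d ∈ m.divisors, ∑ k ∈ n.divisors.filter (fun k => m / d ∣ r ^ k - 1),
        d.gcd (∑ i ∈ Finset.range (n / k), (r ^ k) ^ i) := by
  let T : Finset (Σ _ : ℕ, Σ _ : ℕ, ℕ) := m.divisors.sigma fun d =>
    (n.divisors.filter (fun k => m / d ∣ r ^ k - 1)).sigma fun k =>
      (Finset.range d).filter fun s => d ∣ s * ∑ i ∈ Finset.range (n / k), (r ^ k) ^ i
  have hT : ∀ d k s, (⟨d, k, s⟩ : Σ _ : ℕ, Σ _ : ℕ, ℕ) ∈ T ↔ d ∣ m ∧ k ∣ n ∧ m / d ∣ r ^ k - 1 ∧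
      s < d ∧ d ∣ s * ∑ i ∈ Finset.range (n / k), (r ^ k) ^ i := fun d k s => by
    simp [T, hm.ne', hn.ne', and_assoc]
  let f : (Σ _ : ℕ, Σ _ : ℕ, ℕ) → Subgroup G := fun t => sub a b t.1 t.2.1 t.2.2
  have hinj : Set.InjOn f T := by
    rintro ⟨d, k, s⟩ ht ⟨d', k', s'⟩ ht' heq
    obtain ⟨hd, hk, hdk, hsd, hs⟩ := (hT _ _ _).1 ht
    obtain ⟨hd', hk', hdk', hsd', hs'⟩ := (hT _ _ _).1 ht'
    replace heq : sub a b d k s = sub a b d' k' s' := heq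
    have hc := (h.commute_iff hr hm hd k s).2 hdk
    have hc' := (h.commute_iff hr hm hd' k' s').2 hdk'
    have hdd : ∀ l : ℤ, (d : ℤ) ∣ l ↔ (d' : ℤ) ∣ l := fun l => by
      rw [← h.zpow_left_mem_sub_iff hd hk hc hs hn, heq,
        h.zpow_left_mem_sub_iff hd' hk' hc' hs' hn]
    have hkk : ∀ l : ℤ, (k : ℤ) ∣ l ↔ (k' : ℤ) ∣ l := fun l => by
      rw [← h.zpow_mem_map_sub_iff (d := d) (s := s) hk, heq, h.zpow_mem_map_sub_iff hk']
    obtain rfl : d = d' := Nat.dvd_antisymm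
      (Int.natCast_dvd_natCast.1 ((hdd _).2 dvd_rfl)) (Int.natCast_dvd_natCast.1 ((hdd _).1 dvd_rfl))
    obtain rfl : k = k' := Nat.dvd_antisymm
      (Int.natCast_dvd_natCast.1 ((hkk _).2 dvd_rfl)) (Int.natCast_dvd_natCast.1 ((hkk _).1 dvd_rfl))
    have hx : b ^ k * a ^ s ∈ sub a b d k s := mem_sup_left (mem_zpowers _)
    have hx' : b ^ k * a ^ s' ∈ sub a b d k s := heq ▸ mem_sup_left (mem_zpowers _)
    have hss : a ^ ((s' : ℤ) - s) ∈ sub a b d k s := by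
      have e : a ^ ((s' : ℤ) - s) = (b ^ k * a ^ s)⁻¹ * (b ^ k * a ^ s') := by
        rw [mul_inv_rev, mul_assoc, inv_mul_cancel_left, sub_eq_neg_add, zpow_add, zpow_neg,
          zpow_natCast, zpow_natCast]
      exact e ▸ mul_mem (inv_mem hx) hx'
    rw [h.zpow_left_mem_sub_iff hd hk hc hs hn, ← Nat.modEq_iff_dvd] at hss
    obtain rfl : s = s' := hss.eq_of_lt_of_lt hsd hsd'
    rfl
  have himage : f '' T = {H : Subgroup G | IsCyclic H} := by
    ext H
    constructor
    · rintro ⟨⟨d, k, s⟩, ht, rfl⟩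
      obtain ⟨hd, hk, hdk, -, hs⟩ := (hT _ _ _).1 ht
      exact h.isCyclic_sub hd hk ((h.commute_iff hr hm hd k s).2 hdk) hmn hs
    · intro hH
      have : IsCyclic H := hH
      obtain ⟨d, k, s, hd, hk, hdk, hsd, hs, rfl⟩ := h.exists_eq_sub hm hr H
      exact ⟨⟨d, k, s⟩, (hT _ _ _).2 ⟨hd, hk, hdk, hsd, hs⟩, rfl⟩
  calc Nat.card {H : Subgroup G // IsCyclic H}
      = {H : Subgroup G | IsCyclic H}.ncard := rfl
    _ = T.card := by rw [← himage, hinj.ncard_image, Set.ncard_coe_finset]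
    _ = _ := by
      simp only [T, Finset.card_sigma]
      refine Finset.sum_congr rfl fun d hd => Finset.sum_congr rfl fun k _ => ?_
      exact card_filter_range_dvd_mul (Nat.pos_of_mem_divisors hd) _

end IsZMPair

theorem zm_rels (m n r : ℕ) : za m n r ^ m = 1 ∧ zb m n r ^ n = 1 ∧
    (zb m n r)⁻¹ * za m n r * zb m n r = za m n r ^ r := by
  have key : ∀ x ∈ ZMrel m n r, PresentedGroup.mk (ZMrel m n r) x = 1 := fun x hx =>
    PresentedGroup.one_of_mem hx
  refine ⟨key _ (by simp [ZMrel]), key _ (by simp [ZMrel]), ?_⟩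
  have := key ((FreeGroup.of 1)⁻¹ * FreeGroup.of 0 * FreeGroup.of 1 * (FreeGroup.of 0 ^ r)⁻¹)
    (by simp [ZMrel])
  rw [map_mul, map_inv, mul_inv_eq_one] at this
  exact this

/-- The homomorphism out of `ZM(m,n,r)` determined by images of the generators. -/
def zmLift {G : Type*} [Group G] {m n r : ℕ} (x y : G) (hx : x ^ m = 1) (hy : y ^ n = 1)
    (hxy : x * y = y * x ^ r) : ZM m n r →* G :=
  PresentedGroup.toGroup (f := ![x, y]) (by
    rintro w (rfl | rfl | rfl)
    · simpa using hx
    · simpa using hy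
    · simp [← mul_assoc, mul_assoc y⁻¹, hxy])

theorem zmLift_za {G : Type*} [Group G] {m n r : ℕ} {x y : G} (hx : x ^ m = 1) (hy : y ^ n = 1)
    (hxy : x * y = y * x ^ r) : zmLift x y hx hy hxy (za m n r) = x :=
  PresentedGroup.toGroup.of _

theorem zmLift_zb {G : Type*} [Group G] {m n r : ℕ} {x y : G} (hx : x ^ m = 1) (hy : y ^ n = 1)
    (hxy : x * y = y * x ^ r) : zmLift x y hx hy hxy (zb m n r) = y :=
  PresentedGroup.toGroup.of _

theorem za_mul_zb (m n r : ℕ) : za m n r * zb m n r = zb m n r * za m n r ^ r := by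
  rw [← (zm_rels m n r).2.2]
  group

/-- The order of `a` is exactly `m`, because `ZM(m,n,r)` acts on `ℤ/m` with `a` translating by `1`
and `b` multiplying by `r⁻¹`. -/
theorem orderOf_za {m n r : ℕ} (hn : 0 < n) (h3 : r ^ n ≡ 1 [MOD m]) : orderOf (za m n r) = m := by
  refine Nat.dvd_antisymm (orderOf_dvd_of_pow_eq_one (zm_rels m n r).1) ?_
  have hu : (r : ZMod m) ^ n = 1 := by
    have := (ZMod.natCast_eq_natCast_iff _ _ _).2 h3
    simpa using this
  let u : (ZMod m)ˣ := Units.ofPowEqOne (r : ZMod m) n hu hn.ne'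
  let x : Equiv.Perm (ZMod m) := Equiv.addRight 1
  let y : Equiv.Perm (ZMod m) := MulAction.toPerm u⁻¹
  have hxk : ∀ (k : ℕ) (z : ZMod m), (x ^ k) z = z + k := fun k z => by
    simp [x]
  have hx : x ^ m = 1 := by
    ext z
    simp [hxk]
  have hy : y ^ n = 1 := by
    have : u⁻¹ ^ n = 1 := by
      rw [inv_pow, inv_eq_one]
      exact Units.ext (by simp [u])
    change (MulAction.toPermHom (ZMod m)ˣ (ZMod m) u⁻¹) ^ n = 1
    rw [← map_pow, this, map_one]
  have hxy : x * y = y * x ^ r := by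
    refine Equiv.ext fun z => ?_
    have hur : ((u⁻¹ : (ZMod m)ˣ) : ZMod m) * (r : ZMod m) = 1 := u.inv_mul
    rw [Equiv.Perm.mul_apply, Equiv.Perm.mul_apply, hxk]
    simp [x, y, Units.smul_def, hur]
  have h1 : x ^ orderOf (za m n r) = 1 := by
    rw [← zmLift_za hx hy hxy, ← map_pow, pow_orderOf_eq_one, map_one]
  have h2 := hxk (orderOf (za m n r)) 0
  rw [h1, Equiv.Perm.one_apply, zero_add] at h2
  exact (ZMod.natCast_eq_zero_iff _ _).1 h2.symm

/-- The projection of `ZM(m,n,r)` onto the cyclic group of order `n` generated by `b`. -/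
def zmProj (m n r : ℕ) : ZM m n r →* Multiplicative (ZMod n) :=
  zmLift 1 (ofAdd 1) (one_pow m) (by rw [← ofAdd_nsmul]; simp) (by simp)

/-- Every element of `ZM(m,n,r)` has the form `b ^ j * a ^ i`. -/
theorem exists_eq_pow_mul_pow {m n r : ℕ} (hm : 0 < m) (hn : 0 < n) (g : ZM m n r) :
    ∃ j i : ℕ, g = zb m n r ^ j * za m n r ^ i := by
  obtain ⟨ha, hb, -⟩ := zm_rels m n r
  have hsemi : SemiconjBy (zb m n r) (za m n r ^ r) (za m n r) := (za_mul_zb m n r).symm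
  have hmulb : ∀ g, (∃ j i : ℕ, g = zb m n r ^ j * za m n r ^ i) →
      ∃ j i : ℕ, g * zb m n r = zb m n r ^ j * za m n r ^ i := by
    rintro _ ⟨j, i, rfl⟩
    refine ⟨j + 1, r * i, ?_⟩
    rw [mul_assoc, ← (hsemi.pow_right i).eq, pow_succ, pow_mul, mul_assoc]
  have hmula : ∀ g, (∃ j i : ℕ, g = zb m n r ^ j * za m n r ^ i) →
      ∃ j i : ℕ, g * za m n r = zb m n r ^ j * za m n r ^ i := by
    rintro _ ⟨j, i, rfl⟩
    exact ⟨j, i + 1, by rw [mul_assoc, pow_succ]⟩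
  have hiter : ∀ x : ZM m n r, (∀ g, (∃ j i : ℕ, g = zb m n r ^ j * za m n r ^ i) →
      ∃ j i : ℕ, g * x = zb m n r ^ j * za m n r ^ i) → ∀ (t : ℕ) (g : ZM m n r),
      (∃ j i : ℕ, g = zb m n r ^ j * za m n r ^ i) →
      ∃ j i : ℕ, g * x ^ t = zb m n r ^ j * za m n r ^ i := by
    intro x hx t
    induction t with
    | zero => simp
    | succ t ih =>
      intro g hg
      rw [pow_succ, ← mul_assoc]
      exact hx _ (ih g hg)
  have hinv : ∀ (x : ZM m n r) (N : ℕ), 0 < N → x ^ N = 1 → x⁻¹ = x ^ (N - 1) := by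
    intro x N hN hx
    rw [inv_eq_iff_mul_eq_one, ← pow_succ', Nat.sub_add_cancel hN, hx]
  have hg : g ∈ closure (Set.range (PresentedGroup.of (rels := ZMrel m n r))) := by
    rw [PresentedGroup.closure_range_of]
    trivial
  induction hg using closure_induction_right with
  | one => exact ⟨0, 0, by simp⟩
  | mul_right x _ y hy ih =>
    obtain ⟨i, rfl⟩ := hy
    fin_cases i
    · exact hmula x ih
    · exact hmulb x ih
  | mul_inv_cancel x _ y hy ih =>
    obtain ⟨i, rfl⟩ := hy
    fin_cases i
    · change ∃ j i : ℕ, x * (za m n r)⁻¹ = _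
      rw [hinv _ m hm ha]
      exact hiter _ hmula _ x ih
    · change ∃ j i : ℕ, x * (zb m n r)⁻¹ = _
      rw [hinv _ n hn hb]
      exact hiter _ hmulb _ x ih

theorem ker_zmProj {m n r : ℕ} (hm : 0 < m) (hn : 0 < n) :
    (zmProj m n r).ker = zpowers (za m n r) := by
  have hb : zmProj m n r (zb m n r) = ofAdd 1 := zmLift_zb _ _ _
  have ha : zmProj m n r (za m n r) = 1 := zmLift_za _ _ _
  refine le_antisymm (fun g hg => ?_) (by simpa using ha)
  obtain ⟨j, i, rfl⟩ := exists_eq_pow_mul_pow hm hn g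
  rw [MonoidHom.mem_ker, map_mul, map_pow, map_pow, ha, hb, one_pow, mul_one, ← ofAdd_nsmul,
    ofAdd_eq_one, nsmul_one, ZMod.natCast_eq_zero_iff] at hg
  obtain ⟨t, rfl⟩ := hg
  rw [pow_mul, (zm_rels m n r).2.1, one_pow, one_mul]
  exact pow_mem (mem_zpowers _) i

theorem isZMPair_za_zb {m n r : ℕ} (hm : 0 < m) (hn : 0 < n) (h3 : r ^ n ≡ 1 [MOD m]) :
    IsZMPair m n r (za m n r) (zb m n r) (zmProj m n r) where
  orderOf_left := orderOf_za hn h3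
  mul_eq := za_mul_zb m n r
  map_right := zmLift_zb _ _ _
  ker_eq := ker_zmProj hm hn
  pow_right := (zm_rels m n r).2.1

theorem gcd_pow_sub_one_div {m n r d k : ℕ} (hr : 0 < r)
    (h2 : Nat.gcd m (r - 1) = 1) (hn : 0 < n) (hd : d ∣ m) (hk : k ∣ n) :
    d.gcd ((r ^ n - 1) / (r ^ k - 1)) = d.gcd (∑ i ∈ Finset.range (n / k), (r ^ k) ^ i) := by
  obtain rfl | hr1 : r = 1 ∨ 2 ≤ r := by omega
  · obtain rfl : m = 1 := by simpa using h2
    rw [Nat.dvd_one.1 hd, Nat.gcd_one_left, Nat.gcd_one_left]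
  · have hk0 : k ≠ 0 := (Nat.pos_of_dvd_of_pos hk hn).ne'
    rw [Nat.geomSum_eq (hr1.trans (Nat.le_self_pow hk0 r)), ← pow_mul, Nat.mul_div_cancel' hk]

/-- The number of cyclic subgroups of `ZM(m,n,r)` equals the sum of
`gcd(m₁, (r^n−1)/(r^{n₁}−1))` over pairs `(m₁,n₁)` with `m₁ ∣ m`, `n₁ ∣ n` and
`(m/m₁) ∣ (r^{n₁}−1)`. -/
theorem card_cyclic_subgroups_ZM (m n r : ℕ)
    (hm : 0 < m) (hn : 0 < n) (hr : 0 < r)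
    (h1 : Nat.gcd m n = 1) (h2 : Nat.gcd m (r - 1) = 1) (h3 : r ^ n ≡ 1 [MOD m]) :
    Nat.card {H : Subgroup (ZM m n r) // IsCyclic H} =
      ∑ m₁ ∈ m.divisors, ∑ n₁ ∈ n.divisors.filter (fun n₁ => (m / m₁) ∣ r ^ n₁ - 1),
        Nat.gcd m₁ ((r ^ n - 1) / (r ^ n₁ - 1)) := by
  rw [(isZMPair_za_zb hm hn h3).card_isCyclic hm hn hr h1]
  refine Finset.sum_congr rfl fun d hd => Finset.sum_congr rfl fun k hk => ?_
  exact (gcd_pow_sub_one_div hr h2 hn (Nat.dvd_of_mem_divisors hd)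
    (Nat.dvd_of_mem_divisors (Finset.mem_filter.1 hk).1)).symm
end

section
/- In ZM(m,n,r), a pair of subgroups (H₂, H₃) with H₂ of order mn/(m₂n₂) and H₃ of order mn/(m₃n₃) satisfies H₂H₃ = ZM(m,n,r) if and only if gcd(m₂,m₃) = 1 and gcd(n₂,n₃) = 1. -/
open Pointwise

namespace Subgroup

variable {G : Type*} [Group G]

theorem mul_eq_univ_iff_relIndex_eq_index [Finite G] (H K : Subgroup G) :
    (H : Set G) * (K : Set G) = Set.univ ↔ K.relIndex H = K.index := by
  have hstab : MulAction.stabilizer H ((1 : G) : G ⧸ K) = K.subgroupOf H := by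
    ext x
    rw [MulAction.mem_stabilizer_iff, mem_subgroupOf]
    change ((((x : G) * 1 : G)) : G ⧸ K) = ((1 : G) : G ⧸ K) ↔ _
    rw [mul_one, eq_comm, QuotientGroup.eq]
    simp
  have horbit : MulAction.orbit H ((1 : G) : G ⧸ K) = Set.univ ↔
      (H : Set G) * (K : Set G) = Set.univ := by
    simp only [Set.eq_univ_iff_forall]
    constructor
    · intro h g
      obtain ⟨x, hx⟩ := h (g : G ⧸ K)
      change ((((x : G) * 1 : G)) : G ⧸ K) = (g : G ⧸ K) at hx
      rw [mul_one, QuotientGroup.eq] at hx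
      exact ⟨x, x.2, _, hx, by simp⟩
    · intro h q
      obtain ⟨g, rfl⟩ := QuotientGroup.mk_surjective q
      obtain ⟨x, hx, y, hy, rfl⟩ := h g
      refine ⟨⟨x, hx⟩, ?_⟩
      change (((x * 1 : G)) : G ⧸ K) = ((x * y : G) : G ⧸ K)
      rw [mul_one, QuotientGroup.eq]
      simpa using hy
  rw [← horbit, relIndex, ← hstab, MulAction.index_stabilizer, index, ← Set.ncard_univ]
  exact ⟨fun h => by rw [h], fun h => Set.eq_of_subset_of_ncard_le (Set.subset_univ _) h.ge⟩

theorem index_inf_eq_relIndex_mul_index (H K : Subgroup G) :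
    (H ⊓ K).index = K.relIndex H * H.index := by
  rw [← inf_relIndex_left, relIndex_mul_index inf_le_left]

theorem index_inf_of_mul_eq_univ [Finite G] {H K : Subgroup G}
    (h : (H : Set G) * (K : Set G) = Set.univ) : (H ⊓ K).index = H.index * K.index := by
  rw [index_inf_eq_relIndex_mul_index, (mul_eq_univ_iff_relIndex_eq_index H K).1 h, mul_comm]

theorem mul_eq_univ_of_coprime_index [Finite G] {H K : Subgroup G}
    (h : H.index.Coprime K.index) : (H : Set G) * (K : Set G) = Set.univ := by
  rw [mul_eq_univ_iff_relIndex_eq_index]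
  apply le_antisymm
  · rw [← relIndex_top_right K]
    exact relIndex_le_of_le_right le_top (by simp [index_ne_zero_of_finite])
  · have hdvd : K.index ∣ K.relIndex H * H.index := by
      rw [← index_inf_eq_relIndex_mul_index]
      exact index_dvd_of_le inf_le_right
    exact Nat.le_of_dvd (Nat.pos_of_ne_zero index_ne_zero_of_finite)
      (h.symm.dvd_of_dvd_mul_right hdvd)

theorem coprime_index_of_index_inf_eq_mul [Finite G] [IsCyclic G] {A B : Subgroup G}
    (h : (A ⊓ B).index = A.index * B.index) : A.index.Coprime B.index := by
  have hnormal (D : Subgroup G) : D.Normal :=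
    ⟨fun x hx y => by rwa [mul_comm' y x, mul_inv_cancel_right]⟩
  have := hnormal
  obtain ⟨g, hg⟩ := IsCyclic.exists_generator (α := G)
  have hA : g ^ A.index ∈ A := A.pow_index_mem g
  have hB : g ^ B.index ∈ B := B.pow_index_mem g
  have hlcm : g ^ A.index.lcm B.index ∈ A ⊓ B := by
    obtain ⟨c, hc⟩ := Nat.dvd_lcm_left A.index B.index
    obtain ⟨d, hd⟩ := Nat.dvd_lcm_right A.index B.index
    constructor
    · rw [hc, pow_mul]; exact pow_mem hA c
    · rw [hd, pow_mul]; exact pow_mem hB d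
  have hdvd : (A ⊓ B).index ∣ A.index.lcm B.index := by
    rw [index, ← orderOf_eq_card_of_forall_mem_zpowers (g := (g : G ⧸ A ⊓ B))]
    · apply orderOf_dvd_of_pow_eq_one
      rw [← QuotientGroup.mk_pow]
      exact (QuotientGroup.eq_one_iff _).2 hlcm
    · intro q
      obtain ⟨x, rfl⟩ := QuotientGroup.mk_surjective q
      obtain ⟨k, rfl⟩ := hg x
      exact ⟨k, rfl⟩
  have hle := Nat.le_of_dvd (Nat.lcm_pos (Nat.pos_of_ne_zero index_ne_zero_of_finite)
    (Nat.pos_of_ne_zero index_ne_zero_of_finite)) hdvd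
  rw [h, ← Nat.gcd_mul_lcm A.index B.index] at hle
  have hlpos : 0 < A.index.lcm B.index :=
    Nat.lcm_pos (Nat.pos_of_ne_zero index_ne_zero_of_finite)
      (Nat.pos_of_ne_zero index_ne_zero_of_finite)
  have hgpos : 0 < A.index.gcd B.index :=
    Nat.gcd_pos_of_pos_left _ (Nat.pos_of_ne_zero index_ne_zero_of_finite)
  exact le_antisymm (by nlinarith) hgpos

theorem relIndex_ker_mul_index_map [Finite G] {C : Type*} [Group C] {f : G →* C}
    (hf : Function.Surjective f) (H : Subgroup G) :
    H.relIndex f.ker * (H.map f).index = H.index := by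
  have h₁ : f.ker.relIndex H * (H ⊔ f.ker).index = f.ker.index := by
    rw [← relIndex_sup_right, relIndex_mul_index le_sup_right]
  have h₂ : H.relIndex f.ker * f.ker.index = f.ker.relIndex H * H.index := by
    rw [← index_inf_eq_relIndex_mul_index, ← index_inf_eq_relIndex_mul_index, inf_comm]
  rw [index_map, MonoidHom.range_eq_top.2 hf, index_top, mul_one]
  have hpos : 0 < f.ker.relIndex H := Nat.pos_of_ne_zero index_ne_zero_of_finite
  apply Nat.eq_of_mul_eq_mul_left hpos
  rw [← h₂, ← h₁]
  ring

end Subgroup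

theorem Nat.eq_and_eq_of_mul_eq_mul_of_coprime {u v x y : ℕ} (h : u * v = x * y)
    (huy : u.Coprime y) (hxv : x.Coprime v) : u = x ∧ v = y :=
  ⟨Nat.dvd_antisymm (huy.dvd_of_dvd_mul_right (h ▸ dvd_mul_right u v))
      (hxv.dvd_of_dvd_mul_right (h ▸ dvd_mul_right x y)),
    Nat.dvd_antisymm (hxv.symm.dvd_of_dvd_mul_left (h ▸ dvd_mul_left v u))
      (huy.symm.dvd_of_dvd_mul_left (h ▸ dvd_mul_left y x))⟩

/-- In an extension of a cyclic group by a cyclic group of coprime order, the two coprime parts of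
the indices of the factors of a factorization are coprime. -/
theorem Subgroup.coprime_of_mul_eq_univ {G C : Type*} [Group G] [Finite G] [Group C] [IsCyclic C]
    {f : G →* C} (hf : Function.Surjective f) [IsCyclic f.ker]
    (hcop : (Nat.card f.ker).Coprime (Nat.card C)) {H K : Subgroup G} {m₂ n₂ m₃ n₃ : ℕ}
    (hm₂ : m₂ ∣ Nat.card f.ker) (hn₂ : n₂ ∣ Nat.card C)
    (hm₃ : m₃ ∣ Nat.card f.ker) (hn₃ : n₃ ∣ Nat.card C)
    (hH : H.index = m₂ * n₂) (hK : K.index = m₃ * n₃)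
    (h : (H : Set G) * (K : Set G) = Set.univ) : m₂.Coprime m₃ ∧ n₂.Coprime n₃ := by
  have : Finite C := Finite.of_surjective f hf
  have hsplit (L : Subgroup G) {x y : ℕ} (hL : L.index = x * y)
      (hx : x.Coprime (Nat.card C)) (hy : (Nat.card f.ker).Coprime y) :
      L.relIndex f.ker = x ∧ (L.map f).index = y :=
    Nat.eq_and_eq_of_mul_eq_mul_of_coprime ((relIndex_ker_mul_index_map hf L).trans hL)
      (hy.coprime_dvd_left (relIndex_dvd_card L f.ker))
      (hx.coprime_dvd_right (index_dvd_card (L.map f)))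
  have hx₂ := hcop.coprime_dvd_left hm₂
  have hx₃ := hcop.coprime_dvd_left hm₃
  have hy₂ := hcop.coprime_dvd_right hn₂
  have hy₃ := hcop.coprime_dvd_right hn₃
  obtain ⟨hH₁, hH₂⟩ := hsplit H hH hx₂ hy₂
  obtain ⟨hK₁, hK₂⟩ := hsplit K hK hx₃ hy₃
  have hHK : (H ⊓ K).index = m₂ * m₃ * (n₂ * n₃) := by
    rw [index_inf_of_mul_eq_univ h, hH, hK]
    ring
  obtain ⟨hI, -⟩ := hsplit (H ⊓ K) hHK (hx₂.mul_left hx₃) (hy₂.mul_right hy₃)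
  constructor
  · rw [← hH₁, ← hK₁]
    apply coprime_index_of_index_inf_eq_mul
    change (H ⊓ K).relIndex f.ker = H.relIndex f.ker * K.relIndex f.ker
    rw [hI, hH₁, hK₁]
  · rw [← hH₂, ← hK₂]
    apply coprime_index_of_index_inf_eq_mul
    apply index_inf_of_mul_eq_univ
    rw [coe_map, coe_map, ← Set.image_mul, h, Set.image_univ, hf.range_eq]

namespace ZM

variable {m n r : ℕ}

theorem za_pow : za m n r ^ m = 1 :=
  PresentedGroup.one_of_mem (rels := ZMrel m n r) (x := FreeGroup.of 0 ^ m) (by simp [ZMrel])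

theorem zb_pow : zb m n r ^ n = 1 :=
  PresentedGroup.one_of_mem (rels := ZMrel m n r) (x := FreeGroup.of 1 ^ n) (by simp [ZMrel])

theorem zb_inv_mul_za_mul_zb : (zb m n r)⁻¹ * za m n r * zb m n r = za m n r ^ r :=
  mul_inv_eq_one.1 <| PresentedGroup.one_of_mem (rels := ZMrel m n r)
    (x := (FreeGroup.of 1)⁻¹ * FreeGroup.of 0 * FreeGroup.of 1 * (FreeGroup.of 0 ^ r)⁻¹)
    (by simp [ZMrel])

/-- The homomorphism out of `ZM(m,n,r)` given by images of the generators. -/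
def lift {G : Type*} [Group G] (x y : G) (hx : x ^ m = 1) (hy : y ^ n = 1)
    (hxy : y⁻¹ * x * y = x ^ r) : ZM m n r →* G :=
  PresentedGroup.toGroup (f := ![x, y]) <| by
    rintro _ (rfl | rfl | rfl) <;> simp [hx, hy, hxy]

section lift

variable {G : Type*} [Group G] {x y : G} (hx : x ^ m = 1) (hy : y ^ n = 1)
  (hxy : y⁻¹ * x * y = x ^ r)

theorem lift_za : lift x y hx hy hxy (za m n r) = x := by
  simp [lift, za]

theorem lift_zb : lift x y hx hy hxy (zb m n r) = y := by
  simp [lift, zb]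

end lift

theorem zb_pow_inv_mul_za_mul_zb_pow (k : ℕ) :
    (zb m n r ^ k)⁻¹ * za m n r * zb m n r ^ k = za m n r ^ r ^ k := by
  induction k with
  | zero => simp
  | succ k ih =>
    calc (zb m n r ^ (k + 1))⁻¹ * za m n r * zb m n r ^ (k + 1)
        = (zb m n r)⁻¹ * ((zb m n r ^ k)⁻¹ * za m n r * zb m n r ^ k) * zb m n r := by
          rw [pow_succ]; group
      _ = ((zb m n r)⁻¹ * za m n r * zb m n r) ^ r ^ k := by
          rw [ih]
          simpa using (conj_pow (i := r ^ k) (a := (zb m n r)⁻¹) (b := za m n r)).symm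
      _ = za m n r ^ r ^ (k + 1) := by
          rw [zb_inv_mul_za_mul_zb, ← pow_mul, pow_succ']

theorem closure_za_zb : Subgroup.closure {za m n r, zb m n r} = ⊤ := by
  rw [← PresentedGroup.closure_range_of (ZMrel m n r)]
  congr 1
  ext x
  simp [Fin.exists_fin_two, za, zb, eq_comm]

theorem zpowers_za_normal (hn : 0 < n) : (Subgroup.zpowers (za m n r)).Normal := by
  have hconj {g : ZM m n r} (h : g * za m n r * g⁻¹ ∈ Subgroup.zpowers (za m n r))
      (h' : g⁻¹ * za m n r * g ∈ Subgroup.zpowers (za m n r)) :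
      g ∈ Subgroup.normalizer (Subgroup.zpowers (za m n r) : Set (ZM m n r)) := by
    have key {g : ZM m n r} (h : g * za m n r * g⁻¹ ∈ Subgroup.zpowers (za m n r))
        {x : ZM m n r} (hx : x ∈ Subgroup.zpowers (za m n r)) :
        g * x * g⁻¹ ∈ Subgroup.zpowers (za m n r) := by
      obtain ⟨k, rfl⟩ := hx
      simpa only [conj_zpow] using zpow_mem h k
    refine Subgroup.mem_normalizer_iff.2 fun x => ⟨key h, fun hx => ?_⟩
    simpa [mul_assoc] using key (g := g⁻¹) (by simpa using h') hx
  rw [← Subgroup.normalizer_eq_top_iff, ← top_le_iff, ← closure_za_zb, Subgroup.closure_le]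
  rintro _ (rfl | rfl)
  · exact Subgroup.le_normalizer (Subgroup.mem_zpowers _)
  · apply hconj
    · have hinv : zb m n r ^ (n - 1) = (zb m n r)⁻¹ :=
        eq_inv_of_mul_eq_one_left (by rw [← pow_succ, Nat.sub_add_cancel hn, zb_pow])
      have := zb_pow_inv_mul_za_mul_zb_pow (m := m) (n := n) (r := r) (n - 1)
      rw [hinv, inv_inv] at this
      rw [this]
      exact Subgroup.npow_mem_zpowers _ _
    · rw [zb_inv_mul_za_mul_zb]
      exact Subgroup.npow_mem_zpowers _ _

theorem exists_eq_zpow_mul_zpow (hn : 0 < n) (g : ZM m n r) :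
    ∃ i j : ℤ, g = za m n r ^ i * zb m n r ^ j := by
  have := zpowers_za_normal (m := m) (r := r) hn
  have hg : g ∈ Subgroup.zpowers (za m n r) ⊔ Subgroup.zpowers (zb m n r) := by
    rw [Subgroup.zpowers_eq_closure, Subgroup.zpowers_eq_closure, ← Subgroup.closure_union,
      Set.singleton_union, closure_za_zb]
    trivial
  obtain ⟨_, ⟨i, rfl⟩, _, ⟨j, rfl⟩, rfl⟩ := Subgroup.mem_sup_of_normal_left.1 hg
  exact ⟨i, j, rfl⟩

theorem orderOf_za (hn : 0 < n) (hr : r ^ n ≡ 1 [MOD m]) : orderOf (za m n r) = m := by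
  have hr' : (r : ZMod m) ^ n = 1 := by
    exact_mod_cast (ZMod.natCast_eq_natCast_iff _ _ _).2 hr
  obtain ⟨u, hu, hur⟩ : ∃ u : (ZMod m)ˣ, u ^ n = 1 ∧ (u : ZMod m) = r :=
    ⟨Units.ofPowEqOne (r : ZMod m) n hr' hn.ne', Units.pow_ofPowEqOne hr' hn.ne', rfl⟩
  have hpow (k : ℕ) : (Equiv.addRight (1 : ZMod m)) ^ k = Equiv.addRight (k : ZMod m) := by
    induction k with
    | zero => ext; simp
    | succ k ih =>
      ext x
      rw [pow_succ, ih]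
      simp [add_assoc, add_comm (1 : ZMod m)]
  let φ : ZM m n r →* Equiv.Perm (ZMod m) :=
    lift (Equiv.addRight 1) (MulAction.toPermHom (ZMod m)ˣ (ZMod m) u⁻¹)
      (by ext; simp [hpow]) (by rw [← map_pow, inv_pow, hu, inv_one, map_one]) (by
        ext x
        rw [hpow, ← map_inv, inv_inv]
        simp [Units.smul_def, ← hur])
  apply Nat.dvd_antisymm (orderOf_dvd_of_pow_eq_one za_pow)
  have h := congrArg φ (pow_orderOf_eq_one (za m n r))
  rw [map_pow, map_one, lift_za, hpow] at h
  simpa [ZMod.natCast_eq_zero_iff] using congrArg (fun e => e 0) h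

/-- The quotient map `ZM(m,n,r) → ℤ/n` killing `a` and sending `b` to a generator. -/
def toZMod (m n r : ℕ) : ZM m n r →* Multiplicative (ZMod n) :=
  lift 1 (Multiplicative.ofAdd 1) (one_pow m) (by simp [← ofAdd_nsmul]) (by simp)

theorem toZMod_za : toZMod m n r (za m n r) = 1 := lift_za ..

theorem toZMod_zb : toZMod m n r (zb m n r) = Multiplicative.ofAdd 1 := lift_zb ..

theorem toZMod_surjective : Function.Surjective (toZMod m n r) := by
  intro x
  obtain ⟨k, hk⟩ := ZMod.intCast_surjective x.toAdd
  refine ⟨zb m n r ^ k, ?_⟩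
  rw [map_zpow, toZMod_zb, ← ofAdd_zsmul, zsmul_one, hk, ofAdd_toAdd]

theorem ker_toZMod (hn : 0 < n) : (toZMod m n r).ker = Subgroup.zpowers (za m n r) := by
  apply le_antisymm
  · intro g hg
    obtain ⟨i, j, rfl⟩ := exists_eq_zpow_mul_zpow hn g
    rw [MonoidHom.mem_ker, map_mul, map_zpow, map_zpow, toZMod_za, toZMod_zb, one_zpow, one_mul,
      ← ofAdd_zsmul, zsmul_one, ofAdd_eq_one, CharP.intCast_eq_zero_iff (ZMod n) n] at hg
    obtain ⟨k, rfl⟩ := hg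
    rw [zpow_mul, zpow_natCast, zb_pow, one_zpow, mul_one]
    exact Subgroup.zpow_mem_zpowers _ _
  · rw [Subgroup.zpowers_le, MonoidHom.mem_ker, toZMod_za]

theorem card_ker_toZMod (hn : 0 < n) (hr : r ^ n ≡ 1 [MOD m]) :
    Nat.card (toZMod m n r).ker = m := by
  rw [ker_toZMod hn, Nat.card_zpowers, orderOf_za hn hr]

theorem card_eq (hn : 0 < n) (hr : r ^ n ≡ 1 [MOD m]) : Nat.card (ZM m n r) = m * n := by
  rw [← (toZMod m n r).ker.card_mul_index, card_ker_toZMod hn hr, Subgroup.index_ker,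
    (toZMod m n r).range_eq_top_of_surjective toZMod_surjective, Subgroup.card_top,
    Nat.card_congr Multiplicative.toAdd, Nat.card_zmod]

theorem index_eq_of_card_eq (hm : 0 < m) (hn : 0 < n) (hr : r ^ n ≡ 1 [MOD m]) {k : ℕ}
    (hk : k ∣ m * n) {H : Subgroup (ZM m n r)} (hH : Nat.card H = m * n / k) : H.index = k := by
  have hpos : 0 < m * n / k :=
    Nat.div_pos (Nat.le_of_dvd (by positivity) hk) (Nat.pos_of_dvd_of_pos hk (by positivity))
  apply Nat.eq_of_mul_eq_mul_left hpos
  rw [Nat.div_mul_cancel hk, ← hH, H.card_mul_index, card_eq hn hr]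

end ZM

/-- In `ZM(m,n,r)`, subgroups `H₂` of order `mn/(m₂n₂)` and `H₃` of order
`mn/(m₃n₃)` satisfy `H₂H₃ = ZM(m,n,r)` iff `gcd(m₂,m₃) = 1` and `gcd(n₂,n₃) = 1`. -/
theorem ZM_factorization_iff (m n r m₂ n₂ m₃ n₃ : ℕ)
    (hm : 0 < m) (hn : 0 < n) (hr : 0 < r)
    (h1 : Nat.gcd m n = 1) (h2 : Nat.gcd m (r - 1) = 1) (h3 : r ^ n ≡ 1 [MOD m])
    (hm₂ : m₂ ∣ m) (hn₂ : n₂ ∣ n) (hm₃ : m₃ ∣ m) (hn₃ : n₃ ∣ n)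
    (H₂ H₃ : Subgroup (ZM m n r))
    (hH₂ : Nat.card H₂ = m * n / (m₂ * n₂)) (hH₃ : Nat.card H₃ = m * n / (m₃ * n₃)) :
    (H₂ : Set (ZM m n r)) * (H₃ : Set (ZM m n r)) = Set.univ ↔
      Nat.gcd m₂ m₃ = 1 ∧ Nat.gcd n₂ n₃ = 1 := by
  have hfin : Finite (ZM m n r) :=
    Nat.finite_of_card_ne_zero (by rw [ZM.card_eq hn h3]; positivity)
  have hi₂ := ZM.index_eq_of_card_eq hm hn h3 (mul_dvd_mul hm₂ hn₂) hH₂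
  have hi₃ := ZM.index_eq_of_card_eq hm hn h3 (mul_dvd_mul hm₃ hn₃) hH₃
  constructor
  · intro h
    have hker := ZM.card_ker_toZMod hn h3
    have hC : Nat.card (Multiplicative (ZMod n)) = n := by
      rw [Nat.card_congr Multiplicative.toAdd, Nat.card_zmod]
    have hcyc : IsCyclic (ZM.toZMod m n r).ker := by
      rw [ZM.ker_toZMod hn]
      infer_instance
    exact Subgroup.coprime_of_mul_eq_univ (f := ZM.toZMod m n r) ZM.toZMod_surjective
      (by rwa [hker, hC]) (by rwa [hker]) (by rwa [hC]) (by rwa [hker]) (by rwa [hC]) hi₂ hi₃ h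
  · rintro ⟨hmm, hnn⟩
    apply Subgroup.mul_eq_univ_of_coprime_index
    rw [hi₂, hi₃]
    have hmn : ∀ {x y : ℕ}, x ∣ m → y ∣ n → x.Coprime y :=
      fun hx hy => Nat.Coprime.of_dvd hx hy h1
    exact (Nat.Coprime.mul_right hmm (hmn hm₂ hn₃)).mul_left
      (Nat.Coprime.mul_right (hmn hm₃ hn₂).symm hnn)
end

section
/- The subgroup commutativity degree of ZM(9,4,8) equals 13/19. -/
open Pointwise

namespace QuaternionGroup

variable {n : ℕ}

/-- The subgroup of rotations `a k` with `d ∣ k`. -/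
def rotations (d : ℕ) (hd : d ∣ 2 * n) : Subgroup (QuaternionGroup n) where
  carrier := {g | match g with
    | a k => ZMod.castHom hd (ZMod d) k = 0
    | xa _ => False}
  one_mem' := map_zero (ZMod.castHom hd (ZMod d))
  mul_mem' := by
    rintro (k | k) (l | l) hk hl
    · simp only [Set.mem_ofPred_eq, a_mul_a, map_add] at hk hl ⊢
      rw [hk, hl, add_zero]
    all_goals simp_all
  inv_mem' := by
    rintro (k | k) hk
    · change ZMod.castHom hd (ZMod d) (-k) = 0
      rw [map_neg, show ZMod.castHom hd (ZMod d) k = 0 from hk, neg_zero]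
    · exact hk.elim

@[simp]
theorem a_mem_rotations {d : ℕ} {hd : d ∣ 2 * n} {k : ZMod (2 * n)} :
    a k ∈ rotations d hd ↔ ZMod.castHom hd (ZMod d) k = 0 :=
  Iff.rfl

@[simp]
theorem xa_notMem_rotations {d : ℕ} {hd : d ∣ 2 * n} {k : ZMod (2 * n)} :
    xa k ∉ rotations d hd :=
  id

theorem castHom_natCast_self {d : ℕ} (hd : d ∣ n) :
    ZMod.castHom (hd.mul_left 2) (ZMod d) (n : ZMod (2 * n)) = 0 := by
  rw [map_natCast, ZMod.natCast_eq_zero_iff]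
  exact hd

/-- The subgroup generated by `a d` and by the elements `xa k` with `k ≡ c` modulo `d`. -/
def dicyclic (d : ℕ) (hd : d ∣ n) (c : ZMod d) : Subgroup (QuaternionGroup n) where
  carrier := {g | match g with
    | a k => ZMod.castHom (hd.mul_left 2) (ZMod d) k = 0
    | xa k => ZMod.castHom (hd.mul_left 2) (ZMod d) k = c}
  one_mem' := map_zero (ZMod.castHom (hd.mul_left 2) (ZMod d))
  mul_mem' := by
    have hn := castHom_natCast_self hd
    rintro (k | k) (l | l) hk hl <;>
      simp only [Set.mem_ofPred_eq, a_mul_a, a_mul_xa, xa_mul_a, xa_mul_xa, map_add, map_sub]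
        at hk hl ⊢ <;>
      simp only [hk, hl, hn, add_zero, zero_add, sub_zero, sub_self]
  inv_mem' := by
    have hn := castHom_natCast_self hd
    rintro (k | k) hk
    · change ZMod.castHom (hd.mul_left 2) (ZMod d) (-k) = 0
      rw [map_neg, show ZMod.castHom (hd.mul_left 2) (ZMod d) k = 0 from hk, neg_zero]
    · change ZMod.castHom (hd.mul_left 2) (ZMod d) (n + k) = c
      rw [map_add, hn, show ZMod.castHom (hd.mul_left 2) (ZMod d) k = c from hk, zero_add]

@[simp]
theorem a_mem_dicyclic {d : ℕ} {hd : d ∣ n} {c : ZMod d} {k : ZMod (2 * n)} :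
    a k ∈ dicyclic d hd c ↔ ZMod.castHom (hd.mul_left 2) (ZMod d) k = 0 :=
  Iff.rfl

@[simp]
theorem xa_mem_dicyclic {d : ℕ} {hd : d ∣ n} {c : ZMod d} {k : ZMod (2 * n)} :
    xa k ∈ dicyclic d hd c ↔ ZMod.castHom (hd.mul_left 2) (ZMod d) k = c :=
  Iff.rfl

instance normal_rotations (d : ℕ) (hd : d ∣ 2 * n) : (rotations d hd).Normal where
  conj_mem := by
    rintro (k | k) hk (l | l)
    · change ZMod.castHom hd (ZMod d) (l + k + -l) = 0
      simpa using hk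
    · change ZMod.castHom hd (ZMod d) (n + (n + l) - (l + k)) = 0
      have h2 : (n : ZMod (2 * n)) + n = 0 := by
        rw [← two_mul]
        exact_mod_cast ZMod.natCast_self (2 * n)
      rw [show (n : ZMod (2 * n)) + (n + l) - (l + k) = (n + n) - k by ring, h2, map_sub,
        map_zero, a_mem_rotations.1 hk, sub_zero]
    all_goals exact (xa_notMem_rotations hk).elim

theorem exists_a_mem_iff (H : Subgroup (QuaternionGroup n)) :
    ∃ (d : ℕ) (hd : d ∣ 2 * n), ∀ k, a k ∈ H ↔ ZMod.castHom hd (ZMod d) k = 0 := by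
  let A : AddSubgroup ℤ :=
    { carrier := {m | a (m : ZMod (2 * n)) ∈ H}
      zero_mem' := by simp
      add_mem' := fun {x y} hx hy => by
        simpa using H.mul_mem hx hy
      neg_mem' := fun {x} hx => by
        have h := H.inv_mem hx
        change a (-(x : ZMod (2 * n))) ∈ H at h
        simpa using h }
  obtain ⟨g, hg⟩ := Int.subgroup_cyclic A
  have hA (m : ℤ) : a (m : ZMod (2 * n)) ∈ H ↔ (g.natAbs : ℤ) ∣ m := by
    rw [Int.natAbs_dvd, ← Int.mem_zmultiples_iff, AddSubgroup.zmultiples_eq_closure, ← hg]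
    rfl
  have hd : g.natAbs ∣ 2 * n := by
    rw [← Int.natCast_dvd_natCast, ← hA, Int.cast_natCast, ZMod.natCast_self]
    exact H.one_mem
  refine ⟨g.natAbs, hd, fun k => ?_⟩
  obtain ⟨m, rfl⟩ := ZMod.intCast_surjective k
  rw [hA, map_intCast, ZMod.intCast_zmod_eq_zero_iff_dvd]

theorem eq_rotations_or_eq_dicyclic (H : Subgroup (QuaternionGroup n)) :
    (∃ d hd, H = rotations d hd) ∨ ∃ d hd c, H = dicyclic d hd c := by
  obtain ⟨d, hd, hH⟩ := exists_a_mem_iff H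
  by_cases hx : ∃ c, xa c ∈ H
  · obtain ⟨c, hc⟩ := hx
    have hn : a (n : ZMod (2 * n)) ∈ H := by
      simpa using H.mul_mem hc hc
    have hdn : d ∣ n := by
      rwa [hH, map_natCast, ZMod.natCast_eq_zero_iff] at hn
    refine Or.inr ⟨d, hdn, ZMod.castHom hd (ZMod d) c, ?_⟩
    ext (k | k)
    · exact hH k
    · rw [xa_mem_dicyclic, ← sub_eq_zero, ← map_sub, ← hH,
        ← H.mul_mem_cancel_left (y := a (k - c)) hc, xa_mul_a, add_sub_cancel]
  · refine Or.inl ⟨d, hd, ?_⟩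
    ext (k | k)
    · exact hH k
    · exact iff_of_false (fun h => hx ⟨k, h⟩) xa_notMem_rotations

theorem dvd_of_forall_castHom {d e : ℕ} (hd : d ∣ 2 * n) (he : e ∣ 2 * n)
    (h : ∀ k, ZMod.castHom hd (ZMod d) k = 0 → ZMod.castHom he (ZMod e) k = 0) : e ∣ d := by
  have := h (d : ℕ) (by simp)
  rwa [map_natCast, ZMod.natCast_eq_zero_iff] at this

theorem rotations_inj {d e : ℕ} {hd : d ∣ 2 * n} {he : e ∣ 2 * n} :
    rotations d hd = rotations e he ↔ d = e := by
  refine ⟨fun h => ?_, fun h => by subst h; rfl⟩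
  have hk (k) := SetLike.ext_iff.1 h (a k)
  exact Nat.dvd_antisymm (dvd_of_forall_castHom he hd fun k => (hk k).2)
    (dvd_of_forall_castHom hd he fun k => (hk k).1)

theorem eq_of_dicyclic_eq {d e : ℕ} {hd : d ∣ n} {he : e ∣ n} {c : ZMod d} {c' : ZMod e}
    (h : dicyclic d hd c = dicyclic e he c') : d = e := by
  have hk (k) := SetLike.ext_iff.1 h (a k)
  exact Nat.dvd_antisymm (dvd_of_forall_castHom _ _ fun k => (hk k).2)
    (dvd_of_forall_castHom _ _ fun k => (hk k).1)

theorem dicyclic_injective {d : ℕ} (hd : d ∣ n) : Function.Injective (dicyclic d hd) := by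
  intro c c' h
  obtain ⟨k, hk⟩ := ZMod.castHom_surjective (hd.mul_left 2) c
  rw [← hk]
  exact (SetLike.ext_iff.1 h (xa k)).1 hk

theorem rotations_ne_dicyclic {d e : ℕ} (hd : d ∣ 2 * n) (he : e ∣ n) (c : ZMod e) :
    rotations d hd ≠ dicyclic e he c := by
  obtain ⟨k, hk⟩ := ZMod.castHom_surjective (he.mul_left 2) c
  exact fun h => xa_notMem_rotations ((SetLike.ext_iff.1 h (xa k)).2 hk)

theorem castHom_castHom {d e : ℕ} (hde : d ∣ e) (he : e ∣ 2 * n) (k : ZMod (2 * n)) :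
    ZMod.castHom hde (ZMod d) (ZMod.castHom he (ZMod e) k) =
      ZMod.castHom (hde.trans he) (ZMod d) k :=
  RingHom.congr_fun (Subsingleton.elim ((ZMod.castHom hde (ZMod d)).comp
    (ZMod.castHom he (ZMod e))) (ZMod.castHom (hde.trans he) (ZMod d))) k

theorem dicyclic_le_dicyclic {d e : ℕ} (hde : d ∣ e) (he : e ∣ n) (c : ZMod e) :
    dicyclic e he c ≤ dicyclic d (hde.trans he) (ZMod.castHom hde (ZMod d) c) := by
  rintro (k | k) hk
  · rw [a_mem_dicyclic] at hk ⊢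
    rw [← castHom_castHom hde (he.mul_left 2), hk, map_zero]
  · rw [xa_mem_dicyclic] at hk ⊢
    rw [← castHom_castHom hde (he.mul_left 2), hk]

theorem dicyclic_mul_comm_iff (hn : Odd n) {d e : ℕ} (hde : d ∣ e) (he : e ∣ n) (c : ZMod d)
    (c' : ZMod e) :
    (dicyclic d (hde.trans he) c : Set (QuaternionGroup n)) * dicyclic e he c' =
        (dicyclic e he c' : Set (QuaternionGroup n)) * dicyclic d (hde.trans he) c ↔
      c = ZMod.castHom hde (ZMod d) c' := by
  have hle := dicyclic_le_dicyclic hde he c'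
  have hd := hde.trans he
  constructor
  · intro h
    obtain ⟨k, hk⟩ := ZMod.castHom_surjective (hd.mul_left 2) c
    obtain ⟨l, hl⟩ := ZMod.castHom_surjective (he.mul_left 2) c'
    have hl' := xa_mem_dicyclic.1 (hle (xa_mem_dicyclic.2 hl))
    have hmem : xa l * xa k ∈
        (dicyclic d (hde.trans he) c : Set (QuaternionGroup n)) * dicyclic e he c' := by
      rw [h]
      exact Set.mul_mem_mul (xa_mem_dicyclic.2 hl) (xa_mem_dicyclic.2 hk)
    obtain ⟨u, hu, v, hv, huv⟩ := hmem
    replace hv := hle hv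
    have hself := castHom_natCast_self hd
    rcases u with u | u <;> rcases v with v | v <;>
      simp only [a_mul_a, a_mul_xa, xa_mul_a, xa_mul_xa, a.injEq, reduceCtorEq] at huv
    · have := congrArg (ZMod.castHom (hd.mul_left 2) (ZMod d)) huv
      rw [map_add, map_sub, map_add, a_mem_dicyclic.1 hu, a_mem_dicyclic.1 hv, hk, hl', hself,
        zero_add, zero_add] at this
      exact sub_eq_zero.1 this.symm
    · have := congrArg (ZMod.castHom (hd.mul_left 2) (ZMod d)) huv
      rw [map_sub, map_add, map_sub, map_add, xa_mem_dicyclic.1 hu, xa_mem_dicyclic.1 hv, hk, hl',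
        hself, zero_add, zero_add] at this
      have hcop : Nat.Coprime 2 d := (Nat.coprime_two_left).2 (hn.of_dvd_nat hd)
      have hunit : IsUnit ((2 : ℕ) : ZMod d) := (ZMod.isUnit_iff_coprime 2 d).2 hcop
      refine hunit.mul_left_cancel ?_
      push_cast
      linear_combination -this
  · rintro rfl
    have hl : (dicyclic d hd (ZMod.castHom hde (ZMod d) c') : Set (QuaternionGroup n)) *
        dicyclic e he c' = dicyclic d hd (ZMod.castHom hde (ZMod d) c') :=
      (Set.mul_subset_iff.2 fun _ hx _ hy => mul_mem hx (hle hy)).antisymm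
        (Set.subset_mul_left _ (one_mem _))
    have hr : (dicyclic e he c' : Set (QuaternionGroup n)) *
        dicyclic d hd (ZMod.castHom hde (ZMod d) c') =
        dicyclic d hd (ZMod.castHom hde (ZMod d) c') :=
      (Set.mul_subset_iff.2 fun _ hx _ hy => mul_mem (hle hx) hy).antisymm
        (Set.subset_mul_right _ (one_mem _))
    exact hl.trans hr.symm

theorem rotations_mul_comm {d : ℕ} (hd : d ∣ 2 * n) (H : Subgroup (QuaternionGroup n)) :
    (rotations d hd : Set (QuaternionGroup n)) * H = H * rotations d hd := by
  rw [← Subgroup.normal_mul, ← Subgroup.mul_normal, sup_comm]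

/-- The index set of the subgroups of `QuaternionGroup n`. -/
abbrev SubgroupIndex (n : ℕ) : Type :=
  (2 * n).divisors ⊕ Σ d : n.divisors, Fin d

/-- The subgroup of `QuaternionGroup n` with a given index. -/
def subgroupOfIndex : SubgroupIndex n → Subgroup (QuaternionGroup n)
  | .inl d => rotations d (Nat.dvd_of_mem_divisors d.2)
  | .inr ⟨d, c⟩ => dicyclic d (Nat.dvd_of_mem_divisors d.2) (c : ℕ)

theorem subgroupOfIndex_bijective (hn : n ≠ 0) :
    Function.Bijective (subgroupOfIndex (n := n)) := by
  constructor
  · rintro (d | ⟨d, c⟩) (e | ⟨e, c'⟩) h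
    · exact congrArg _ (Subtype.ext (rotations_inj.1 h))
    · exact (rotations_ne_dicyclic _ (Nat.dvd_of_mem_divisors e.2) _ h).elim
    · exact (rotations_ne_dicyclic _ (Nat.dvd_of_mem_divisors d.2) _ h.symm).elim
    · obtain rfl : d = e := Subtype.ext (eq_of_dicyclic_eq (hd := Nat.dvd_of_mem_divisors d.2)
        (he := Nat.dvd_of_mem_divisors e.2) h)
      have hc := dicyclic_injective (Nat.dvd_of_mem_divisors d.2) h
      rw [ZMod.natCast_eq_natCast_iff', Nat.mod_eq_of_lt c.2, Nat.mod_eq_of_lt c'.2] at hc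
      rw [Fin.ext hc]
  · intro H
    obtain ⟨d, hd, rfl⟩ | ⟨d, hd, c, rfl⟩ := eq_rotations_or_eq_dicyclic H
    · exact ⟨.inl ⟨d, Nat.mem_divisors.2 ⟨hd, by omega⟩⟩, rfl⟩
    · have : NeZero d := ⟨ne_zero_of_dvd_ne_zero hn hd⟩
      refine ⟨.inr ⟨⟨d, Nat.mem_divisors.2 ⟨hd, hn⟩⟩, ⟨c.val, c.val_lt⟩⟩, ?_⟩
      simp [subgroupOfIndex]

/-- A criterion on the indices of two subgroups of `QuaternionGroup n` which, for `n` an odd prime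
power, expresses that the subgroups permute. -/
def Permutes : SubgroupIndex n → SubgroupIndex n → Prop
  | .inr ⟨d, c⟩, .inr ⟨e, c'⟩ => (c : ℕ) ≡ c' [MOD min d e]
  | _, _ => True

instance : DecidableRel (Permutes (n := n))
  | .inr ⟨d, c⟩, .inr ⟨e, c'⟩ => inferInstanceAs (Decidable ((c : ℕ) ≡ c' [MOD min d e]))
  | .inl _, .inl _ => instDecidableTrue
  | .inl _, .inr _ => instDecidableTrue
  | .inr _, .inl _ => instDecidableTrue

theorem subgroupOfIndex_mul_comm_iff {p m : ℕ} (hp : p.Prime) (hodd : Odd (p ^ m))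
    (i j : SubgroupIndex (p ^ m)) :
    (subgroupOfIndex i : Set (QuaternionGroup (p ^ m))) * subgroupOfIndex j =
      (subgroupOfIndex j : Set (QuaternionGroup (p ^ m))) * subgroupOfIndex i ↔
      Permutes i j := by
  rcases i with d | ⟨⟨d, hd⟩, c⟩
  · exact iff_of_true (rotations_mul_comm _ _) (by cases j <;> trivial)
  rcases j with e | ⟨⟨e, he⟩, c'⟩
  · exact iff_of_true (rotations_mul_comm _ _).symm trivial
  have hd0 := Nat.pos_of_mem_divisors hd
  have he0 := Nat.pos_of_mem_divisors he
  have hchain : d ∣ e ∨ e ∣ d := by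
    obtain ⟨s, -, rfl⟩ := (Nat.dvd_prime_pow hp).1 (Nat.dvd_of_mem_divisors hd)
    obtain ⟨t, -, rfl⟩ := (Nat.dvd_prime_pow hp).1 (Nat.dvd_of_mem_divisors he)
    exact (le_total s t).imp (pow_dvd_pow p) (pow_dvd_pow p)
  rcases hchain with h | h
  · refine (dicyclic_mul_comm_iff hodd h (Nat.dvd_of_mem_divisors he) _ _).trans ?_
    rw [map_natCast, ZMod.natCast_eq_natCast_iff]
    simp [Permutes, min_eq_left (Nat.le_of_dvd he0 h)]
  · refine eq_comm.trans
      ((dicyclic_mul_comm_iff hodd h (Nat.dvd_of_mem_divisors hd) _ _).trans ?_)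
    rw [map_natCast, ZMod.natCast_eq_natCast_iff]
    simp [Permutes, min_eq_right (Nat.le_of_dvd hd0 h), Nat.ModEq.comm]

variable {G : Type*} [Group G]

theorem zpow_mul_of_mul_eq_inv_mul {r x : G} (h : r * x = x * r⁻¹) (m : ℤ) :
    r ^ m * x = x * r ^ (-m) := by
  have h' : SemiconjBy x r⁻¹ r := h.symm
  simpa using (h'.zpow_right m).eq.symm

/-- The homomorphism `k ↦ r ^ k` from `ZMod m`, for an element `r` with `r ^ m = 1`. -/
def zmodPowersHom {m : ℕ} (r : G) (hr : r ^ m = 1) : ZMod m →+ Additive G :=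
  ZMod.lift m ⟨zmultiplesHom (Additive G) (Additive.ofMul r), by
    rw [zmultiplesHom_apply, natCast_zsmul, ← ofMul_pow, hr, ofMul_one]⟩

theorem toMul_zmodPowersHom_intCast {m : ℕ} (r : G) (hr : r ^ m = 1) (k : ℤ) :
    (zmodPowersHom r hr k).toMul = r ^ k := by
  rw [zmodPowersHom, ZMod.lift_coe]
  rfl

/-- The homomorphism from `QuaternionGroup n` with `a 1 ↦ r` and `xa 0 ↦ x`. -/
def lift (r x : G) (hr : r ^ (2 * n) = 1) (hx : x * x = r ^ n) (h : r * x = x * r⁻¹) :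
    QuaternionGroup n →* G where
  toFun
    | a k => (zmodPowersHom r hr k).toMul
    | xa k => x * (zmodPowersHom r hr k).toMul
  map_one' := congrArg Additive.toMul (map_zero (zmodPowersHom r hr))
  map_mul' := by
    have hz := zpow_mul_of_mul_eq_inv_mul h
    have hf := toMul_zmodPowersHom_intCast r hr
    rintro (k | k) (l | l) <;> obtain ⟨k, rfl⟩ := ZMod.intCast_surjective k <;>
      obtain ⟨l, rfl⟩ := ZMod.intCast_surjective l
    · simp only [a_mul_a, ← Int.cast_add, hf, zpow_add]
    · simp only [a_mul_xa, ← Int.cast_sub, hf]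
      rw [← mul_assoc, hz, mul_assoc, ← zpow_add, neg_add_eq_sub]
    · simp only [xa_mul_a, ← Int.cast_add, hf, zpow_add, mul_assoc]
    · simp only [xa_mul_xa]
      rw [← Int.cast_natCast (R := ZMod (2 * n)) n, ← Int.cast_add, ← Int.cast_sub]
      simp only [hf]
      rw [mul_assoc x, ← mul_assoc _ x, hz, ← mul_assoc, ← mul_assoc, hx, ← zpow_natCast,
        ← zpow_add, ← zpow_add]
      congr 1
      ring

theorem lift_a (r x : G) (hr : r ^ (2 * n) = 1) (hx : x * x = r ^ n) (h : r * x = x * r⁻¹)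
    (k : ℕ) : lift r x hr hx h (a k) = r ^ k := by
  have h := toMul_zmodPowersHom_intCast r hr k
  rw [Int.cast_natCast, zpow_natCast] at h
  exact h

theorem lift_xa_zero (r x : G) (hr : r ^ (2 * n) = 1) (hx : x * x = r ^ n)
    (h : r * x = x * r⁻¹) : lift r x hr hx h (xa 0) = x := by
  change x * (zmodPowersHom r hr 0).toMul = x
  rw [map_zero, toMul_zero, mul_one]

end QuaternionGroup

open QuaternionGroup

theorem za_pow (m n r : ℕ) : za m n r ^ m = 1 := by
  have h := PresentedGroup.one_of_mem (rels := ZMrel m n r) (x := FreeGroup.of 0 ^ m)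
    (by simp [ZMrel])
  rwa [map_pow] at h

theorem zb_pow (m n r : ℕ) : zb m n r ^ n = 1 := by
  have h := PresentedGroup.one_of_mem (rels := ZMrel m n r) (x := FreeGroup.of 1 ^ n)
    (by simp [ZMrel])
  rwa [map_pow] at h

theorem zb_inv_mul_za_mul_zb (m n r : ℕ) :
    (zb m n r)⁻¹ * za m n r * zb m n r = za m n r ^ r := by
  have h := PresentedGroup.one_of_mem (rels := ZMrel m n r)
    (x := (FreeGroup.of 1)⁻¹ * FreeGroup.of 0 * FreeGroup.of 1 * (FreeGroup.of 0 ^ r)⁻¹)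
    (by simp [ZMrel])
  rw [map_mul, map_inv, map_pow] at h
  exact mul_inv_eq_one.1 h

theorem za_mul_zb_s12 : za 9 4 8 * zb 9 4 8 = zb 9 4 8 * (za 9 4 8)⁻¹ := by
  have h : (za 9 4 8)⁻¹ = za 9 4 8 ^ 8 := by
    rw [inv_eq_iff_mul_eq_one, ← pow_succ', za_pow]
  rw [h, ← zb_inv_mul_za_mul_zb, mul_assoc, mul_inv_cancel_left]

theorem commute_za_zb_sq : Commute (za 9 4 8) (zb 9 4 8 ^ 2) := by
  have h : SemiconjBy (zb 9 4 8) (za 9 4 8)⁻¹ (za 9 4 8) := za_mul_zb_s12.symm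
  have h' : SemiconjBy (zb 9 4 8) (za 9 4 8) (za 9 4 8)⁻¹ := by
    simpa using h.inv_right
  rw [sq]
  exact (h.mul_left h').symm

theorem za_zb_pow (k : ℕ) :
    (za 9 4 8 ^ 5 * zb 9 4 8 ^ 2) ^ k = za 9 4 8 ^ (5 * k % 9) * zb 9 4 8 ^ (2 * k % 4) := by
  rw [(commute_za_zb_sq.pow_left 5).mul_pow, ← pow_mul, ← pow_mul,
    pow_eq_pow_mod (5 * k) (za_pow 9 4 8), pow_eq_pow_mod (2 * k) (zb_pow 9 4 8)]

/-- The homomorphism `ZM(9,4,8) → QuaternionGroup 9` with `za ↦ a 2` and `zb ↦ xa 0`. -/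
def zmToQuaternion : ZM 9 4 8 →* QuaternionGroup 9 :=
  PresentedGroup.toGroup (f := ![a 2, xa 0]) (by
    rintro r (rfl | rfl | rfl) <;>
      simp only [map_pow, map_mul, map_inv, FreeGroup.lift_apply_of] <;> decide)

theorem zmToQuaternion_za : zmToQuaternion (za 9 4 8) = a 2 :=
  PresentedGroup.toGroup.of _

theorem zmToQuaternion_zb : zmToQuaternion (zb 9 4 8) = xa 0 :=
  PresentedGroup.toGroup.of _

/-- The inverse of `zmToQuaternion`. -/
def quaternionToZM : QuaternionGroup 9 →* ZM 9 4 8 :=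
  lift (za 9 4 8 ^ 5 * zb 9 4 8 ^ 2) (zb 9 4 8)
    (by rw [za_zb_pow]; simp)
    (by rw [za_zb_pow]; simp [sq])
    (by
      have h := zpow_mul_of_mul_eq_inv_mul za_mul_zb_s12 5
      have hb : (zb 9 4 8 ^ 2)⁻¹ = zb 9 4 8 ^ 2 := by
        rw [inv_eq_iff_mul_eq_one, ← pow_add, zb_pow]
      rw [mul_inv_rev, hb, ← ((commute_za_zb_sq.pow_left 5).inv_left).eq, mul_assoc,
        ← pow_succ, pow_succ' (zb 9 4 8) 2, ← mul_assoc, ← mul_assoc]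
      exact congrArg (· * zb 9 4 8 ^ 2) h)

theorem quaternionToZM_comp_zmToQuaternion :
    quaternionToZM.comp zmToQuaternion = MonoidHom.id (ZM 9 4 8) := by
  refine PresentedGroup.ext fun i => ?_
  fin_cases i
  · change quaternionToZM (zmToQuaternion (za 9 4 8)) = za 9 4 8
    rw [zmToQuaternion_za]
    refine (lift_a _ _ _ _ _ 2).trans ?_
    rw [za_zb_pow]
    simp
  · change quaternionToZM (zmToQuaternion (zb 9 4 8)) = zb 9 4 8
    rw [zmToQuaternion_zb, quaternionToZM, lift_xa_zero]

theorem zmToQuaternion_surjective : Function.Surjective zmToQuaternion := by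
  have ha (k : ZMod (2 * 9)) : a k ∈ zmToQuaternion.range := by
    have h1 : a 1 ∈ zmToQuaternion.range := by
      refine ⟨za 9 4 8 ^ 5 * zb 9 4 8 ^ 2, ?_⟩
      rw [map_mul, map_pow, map_pow, zmToQuaternion_za, zmToQuaternion_zb]
      decide
    have := pow_mem h1 k.val
    rwa [a_one_pow, ZMod.natCast_zmod_val] at this
  rintro (k | k)
  · exact ha k
  · have := mul_mem (⟨_, zmToQuaternion_zb⟩ : xa 0 ∈ zmToQuaternion.range) (ha k)
    rwa [xa_mul_a, zero_add] at this

/-- `ZM(9,4,8)` is the dicyclic group of order `36`. -/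
noncomputable def zmEquivQuaternion : ZM 9 4 8 ≃* QuaternionGroup 9 :=
  MulEquiv.ofBijective zmToQuaternion
    ⟨Function.LeftInverse.injective (g := quaternionToZM)
      (DFunLike.congr_fun quaternionToZM_comp_zmToQuaternion),
      zmToQuaternion_surjective⟩

theorem Subgroup.map_mul_comm_iff {G G' : Type*} [Group G] [Group G'] (e : G ≃* G')
    (H K : Subgroup G) :
    (H.map (e : G →* G') : Set G') * K.map (e : G →* G') =
        (K.map (e : G →* G') : Set G') * H.map (e : G →* G') ↔
      (H : Set G) * K = (K : Set G) * H := by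
  simp only [Subgroup.coe_map, ← Set.image_mul]
  exact (Set.image_injective.2 e.injective).eq_iff

/-- The subgroups of `ZM(9,4,8)` are indexed by `SubgroupIndex 9`. -/
noncomputable def subgroupIndexEquiv : SubgroupIndex (3 ^ 2) ≃ Subgroup (ZM 9 4 8) :=
  (Equiv.ofBijective _ (subgroupOfIndex_bijective (by norm_num))).trans
    zmEquivQuaternion.symm.mapSubgroup.toEquiv

theorem subgroupIndexEquiv_mul_comm_iff (i j : SubgroupIndex (3 ^ 2)) :
    (subgroupIndexEquiv i : Set (ZM 9 4 8)) * subgroupIndexEquiv j =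
      (subgroupIndexEquiv j : Set (ZM 9 4 8)) * subgroupIndexEquiv i ↔ Permutes i j :=
  (Subgroup.map_mul_comm_iff zmEquivQuaternion.symm _ _).trans
    (subgroupOfIndex_mul_comm_iff Nat.prime_three (by decide) i j)

theorem card_subgroup_ZM948 : Nat.card (Subgroup (ZM 9 4 8)) = 19 := by
  rw [← Nat.card_congr subgroupIndexEquiv, Nat.card_eq_fintype_card]
  decide +kernel

theorem card_permuting_pairs_ZM948 :
    Nat.card {p : Subgroup (ZM 9 4 8) × Subgroup (ZM 9 4 8) //
      (p.1 : Set (ZM 9 4 8)) * (p.2 : Set (ZM 9 4 8)) =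
        (p.2 : Set (ZM 9 4 8)) * (p.1 : Set (ZM 9 4 8))} = 247 := by
  rw [← Nat.card_congr ((subgroupIndexEquiv.prodCongr subgroupIndexEquiv).subtypeEquiv
    (p := fun q => Permutes q.1 q.2) fun q => (subgroupIndexEquiv_mul_comm_iff q.1 q.2).symm),
    Nat.card_eq_fintype_card]
  decide +kernel

/-- The subgroup commutativity degree of `ZM(9,4,8)` equals `13/19`. -/
theorem sd_ZM948 :
    (Nat.card {p : Subgroup (ZM 9 4 8) × Subgroup (ZM 9 4 8) //
        (p.1 : Set (ZM 9 4 8)) * (p.2 : Set (ZM 9 4 8)) =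
          (p.2 : Set (ZM 9 4 8)) * (p.1 : Set (ZM 9 4 8))} : ℚ) /
      (Nat.card (Subgroup (ZM 9 4 8)) : ℚ) ^ 2 = 13 / 19 := by
  rw [card_permuting_pairs_ZM948, card_subgroup_ZM948]
  norm_num
end
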